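/- Let σ be a finite relational vocabulary, A and B finite σ-structures, and k > 0. Then G_k A and G_k B are isomorphic in RT_k(σ) (i.e., there is a bijective σ-homomorphism between them that is an order-isomorphism of the forest orders, whose inverse is also a morphism) if and only if A and B satisfy the same sentences of first-order logic of quantifier rank at most k extended with counting quantifiers ∃^{≥n}. -/

import Mathlib

namespace SP


/-- An interpretation of the relational vocabulary `(σ, ar)` on a carrier type `A`:
each relation symbol `r` of arity `ar r` is interpreted as a set of `ar r`-tuples. -/
def Interp (σ : Type) (ar : σ → ℕ) (A : Type) : Type :=
  ∀ r : σ, Set (Fin (ar r) → A)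

variable {σ : Type} {ar : σ → ℕ}

/-- `f` is a homomorphism of σ-structures. -/
def IsHom {A B : Type} (SA : Interp σ ar A) (SB : Interp σ ar B) (f : A → B) : Prop :=
  ∀ (r : σ) (t : Fin (ar r) → A), t ∈ SA r → (fun i => f (t i)) ∈ SB r

/-- Adjacency in the Gaifman graph of a σ-structure. -/
def GaifmanAdj {A : Type} (SA : Interp σ ar A) (a b : A) : Prop :=
  a ≠ b ∧ ∃ (r : σ) (t : Fin (ar r) → A), t ∈ SA r ∧ (∃ i, t i = a) ∧ (∃ j, t j = b)




/-- First-order formulas with counting quantifiers `∃^{≥n}` over `(σ, ar)`,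
with variables in `ℕ`. -/
inductive CFml (σ : Type) (ar : σ → ℕ) : Type
  | rel (r : σ) (v : Fin (ar r) → ℕ)
  | eq (x y : ℕ)
  | not (φ : CFml σ ar)
  | and (φ ψ : CFml σ ar)
  | or (φ ψ : CFml σ ar)
  | ex (x : ℕ) (φ : CFml σ ar)
  | all (x : ℕ) (φ : CFml σ ar)
  | exCount (n : ℕ) (x : ℕ) (φ : CFml σ ar)

namespace CFml

variable {σ : Type} {ar : σ → ℕ}

/-- Quantifier rank (counting quantifiers included). -/
def qr : CFml σ ar → ℕ
  | rel _ _ => 0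
  | eq _ _ => 0
  | not φ => φ.qr
  | and φ ψ => max φ.qr ψ.qr
  | or φ ψ => max φ.qr ψ.qr
  | ex _ φ => φ.qr + 1
  | all _ φ => φ.qr + 1
  | exCount _ _ φ => φ.qr + 1

/-- Free variables. -/
def fv : CFml σ ar → Finset ℕ
  | rel _ v => Finset.univ.image v
  | eq x y => {x, y}
  | not φ => φ.fv
  | and φ ψ => φ.fv ∪ ψ.fv
  | or φ ψ => φ.fv ∪ ψ.fv
  | ex x φ => φ.fv.erase x
  | all x φ => φ.fv.erase x
  | exCount _ x φ => φ.fv.erase x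

/-- Satisfaction; `∃^{≥n} x φ` holds iff there are at least `n` distinct witnesses. -/
def Sat {A : Type} (SA : Interp σ ar A) : (ℕ → A) → CFml σ ar → Prop
  | η, rel r v => (fun i => η (v i)) ∈ SA r
  | η, eq x y => η x = η y
  | η, not φ => ¬ Sat SA η φ
  | η, and φ ψ => Sat SA η φ ∧ Sat SA η ψ
  | η, or φ ψ => Sat SA η φ ∨ Sat SA η ψ
  | η, ex x φ => ∃ a : A, Sat SA (Function.update η x a) φ
  | η, all x φ => ∀ a : A, Sat SA (Function.update η x a) φ
  | η, exCount n x φ => ∃ s : Finset A, s.card = n ∧ ∀ a ∈ s, Sat SA (Function.update η x a) φ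

end CFml




/-- An order-enriched σ-structure: a σ-structure together with a binary relation `le`
on its universe.  (Forest-ordered σ-structures are those satisfying `IsRT`.) -/
structure OStruct (σ : Type) (ar : σ → ℕ) where
  carrier : Type
  interp : Interp σ ar carrier
  le : carrier → carrier → Prop

namespace OStruct

variable {σ : Type} {ar : σ → ℕ} (X : OStruct σ ar)

/-- The strict order associated to `le`. -/
def slt (x y : X.carrier) : Prop := X.le x y ∧ x ≠ y

/-- `le` is a forest order: a partial order in which the set of strict predecessors of
every element is a finite chain. -/
def IsForestOrder : Prop :=
  (∀ x, X.le x x) ∧ (∀ x y, X.le x y → X.le y x → x = y) ∧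
  (∀ x y z, X.le x y → X.le y z → X.le x z) ∧
  (∀ x, { y | X.slt y x }.Finite) ∧ (∀ x, IsChain X.le { y | X.slt y x })

/-- Condition (E): elements adjacent in the Gaifman graph are comparable. -/
def CondE : Prop := ∀ a b, GaifmanAdj X.interp a b → X.le a b ∨ X.le b a

/-- The forest order has height at most `k`: every chain has cardinality at most `k`. -/
def HeightLE (k : ℕ) : Prop :=
  ∀ s : Finset X.carrier, IsChain X.le (↑s : Set X.carrier) → s.card ≤ k

/-- `X` is an object of `RT_k(σ)`: a forest-ordered σ-structure (condition (E))
of height at most `k`. -/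
def IsRT (k : ℕ) : Prop := X.IsForestOrder ∧ X.CondE ∧ X.HeightLE k

/-- A root: a minimal element of the order. -/
def IsRoot (x : X.carrier) : Prop := ∀ y, X.le y x → y = x

/-- The covering relation of the order. -/
def Covers (x y : X.carrier) : Prop :=
  X.slt x y ∧ ∀ z, X.le x z → X.le z y → z = x ∨ z = y

/-- A path: an object of `RT_k(σ)` whose order is a finite chain. -/
def IsPath (k : ℕ) : Prop :=
  X.IsRT k ∧ Finite X.carrier ∧ ∀ x y : X.carrier, X.le x y ∨ X.le y x

end OStruct

variable {σ : Type} {ar : σ → ℕ}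

/-- Morphisms of forest-ordered σ-structures: σ-homomorphisms preserving roots and
the covering relation. -/
def IsFMor (X Y : OStruct σ ar) (f : X.carrier → Y.carrier) : Prop :=
  IsHom X.interp Y.interp f ∧
  (∀ x, X.IsRoot x → Y.IsRoot (f x)) ∧
  (∀ x y, X.Covers x y → Y.Covers (f x) (f y))

/-- An embedding of σ-structures: an injective homomorphism reflecting all relations.
(Here only the injectivity/reflection part; being a homomorphism is required separately.) -/
def IsStrEmb (X Y : OStruct σ ar) (f : X.carrier → Y.carrier) : Prop :=
  Function.Injective f ∧
  ∀ (r : σ) (t : Fin (ar r) → X.carrier),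
    (fun i => f (t i)) ∈ Y.interp r → t ∈ X.interp r

/-- A path embedding into `X`: a morphism from a path which is an embedding of
σ-structures. -/
def IsPathEmb (k : ℕ) (P X : OStruct σ ar) (m : P.carrier → X.carrier) : Prop :=
  P.IsPath k ∧ IsFMor P X m ∧ IsStrEmb P X m

/-- A pathwise embedding: composition with any path embedding is a path embedding. -/
def IsPathwiseEmb (k : ℕ) (X Y : OStruct σ ar) (f : X.carrier → Y.carrier) : Prop :=
  ∀ (P : OStruct σ ar) (m : P.carrier → X.carrier),
    IsPathEmb k P X m → IsPathEmb k P Y (fun p => f (m p))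

/-- Open maps: the path-lifting property.  Every commutative square whose vertical
sides are path embeddings and whose top side is a morphism of paths has a diagonal
filler. -/
def IsOpen (k : ℕ) (X Y : OStruct σ ar) (f : X.carrier → Y.carrier) : Prop :=
  ∀ (P Q : OStruct σ ar) (mP : P.carrier → X.carrier) (mQ : Q.carrier → Y.carrier)
    (i : P.carrier → Q.carrier),
    IsPathEmb k P X mP → IsPathEmb k Q Y mQ → IsFMor P Q i →
    (∀ p, f (mP p) = mQ (i p)) →
    ∃ j : Q.carrier → X.carrier,
      IsFMor Q X j ∧ (∀ p, j (i p) = mP p) ∧ (∀ q, f (j q) = mQ q)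

/-- Bisimilarity in `RT_k(σ)`: a span of open pathwise embeddings. -/
def Bisimilar (k : ℕ) (X Y : OStruct σ ar) : Prop :=
  ∃ (R : OStruct σ ar) (f : R.carrier → X.carrier) (g : R.carrier → Y.carrier),
    R.IsRT k ∧
    IsFMor R X f ∧ IsPathwiseEmb k R X f ∧ IsOpen k R X f ∧
    IsFMor R Y g ∧ IsPathwiseEmb k R Y g ∧ IsOpen k R Y g




variable {σ : Type} {ar : σ → ℕ}

/-- The universe of `E_k A`: nonempty sequences of elements of `A` of length at most `k`. -/
def EkCarrier (k : ℕ) (A : Type) : Type :=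
  { s : List A // s ≠ [] ∧ s.length ≤ k }

/-- The counit `ε_A : E_k A → A`, sending a sequence to its last element. -/
def εE {k : ℕ} {A : Type} (s : EkCarrier k A) : A := s.1.getLast s.2.1

/-- The interpretation of the relation symbols on `E_k A`: tuples of pairwise
prefix-comparable sequences whose last elements are related in `A`. -/
def EkInterp (k : ℕ) {A : Type} (SA : Interp σ ar A) : Interp σ ar (EkCarrier k A) :=
  fun r =>
    { t | (∀ i j, (t i).1 <+: (t j).1 ∨ (t j).1 <+: (t i).1) ∧
          (fun i => εE (t i)) ∈ SA r }

/-- `G_k A`: the cofree forest-ordered σ-structure on `A`, with the prefix order. -/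
def GkO (k : ℕ) {A : Type} (SA : Interp σ ar A) : OStruct σ ar :=
  ⟨EkCarrier k A, EkInterp k SA, fun s t => s.1 <+: t.1⟩



section Proof

variable {A B : Type}

def At (SA : Interp σ ar A) (SB : Interp σ ar B) (l : List (A × B)) : Prop :=
  ∀ (r : σ) (t : Fin (ar r) → A × B), (∀ i, t i ∈ l) →
    ((fun i => (t i).1) ∈ SA r ↔ (fun i => (t i).2) ∈ SB r)

def G (SA : Interp σ ar A) (SB : Interp σ ar B) : ℕ → List (A × B) → Prop
  | 0, l => At SA SB l
  | m + 1, l => At SA SB l ∧ ∃ h : A ≃ B, ∀ a, G SA SB m ((a, h a) :: l)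

def PI (l : List (A × B)) : Prop := ∀ p ∈ l, ∀ q ∈ l, p.1 = q.1 ↔ p.2 = q.2

def GE (SA : Interp σ ar A) (SB : Interp σ ar B) : ℕ → List (A × B) → Prop
  | 0, l => At SA SB l ∧ PI l
  | m + 1, l => (At SA SB l ∧ PI l) ∧ ∃ h : A ≃ B, ∀ a, GE SA SB m ((a, h a) :: l)

variable {SA : Interp σ ar A} {SB : Interp σ ar B}

theorem At.mono {l l' : List (A × B)} (hl : l' ⊆ l) (h : At SA SB l) : At SA SB l' :=
  fun r t ht => h r t fun i => hl (ht i)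

theorem G.at {m : ℕ} {l : List (A × B)} (h : G SA SB m l) : At SA SB l := by
  cases m with
  | zero => exact h
  | succ m => exact h.1

theorem GE.at {m : ℕ} {l : List (A × B)} (h : GE SA SB m l) : At SA SB l ∧ PI l := by
  cases m with
  | zero => exact h
  | succ m => exact h.1

theorem G.mono {m : ℕ} : ∀ {l l' : List (A × B)}, l' ⊆ l → G SA SB m l → G SA SB m l' := by
  induction m with
  | zero => intro l l' hl h; exact At.mono hl h
  | succ m ih =>
    rintro l l' hl ⟨h1, e, h2⟩
    exact ⟨h1.mono hl, e, fun a => ih (List.cons_subset_cons _ hl) (h2 a)⟩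

theorem G.pred {m : ℕ} : ∀ {l : List (A × B)}, G SA SB (m + 1) l → G SA SB m l := by
  induction m with
  | zero => intro l h; exact h.1
  | succ m ih =>
    rintro l ⟨h1, e, h2⟩
    exact ⟨h1, e, fun a => ih (h2 a)⟩

theorem G.difun {m : ℕ} : ∀ (l : List ((A × B) × (A × B))),
    G SA SB m (l.map fun q => q.1) → G SA SB m (l.map fun q => (q.2.1, q.1.2)) →
    G SA SB m (l.map fun q => q.2) → G SA SB m (l.map fun q => (q.1.1, q.2.2)) := by
  have key : ∀ (l : List ((A × B) × (A × B))),
    At SA SB (l.map fun q => q.1) → At SA SB (l.map fun q => (q.2.1, q.1.2)) →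
    At SA SB (l.map fun q => q.2) → At SA SB (l.map fun q => (q.1.1, q.2.2)) := by
    intro l h1 h2 h3 r t ht
    have : ∀ i, ∃ q ∈ l, t i = (q.1.1, q.2.2) := by
      intro i
      obtain ⟨q, hq, e⟩ := List.mem_map.1 (ht i)
      exact ⟨q, hq, e.symm⟩
    choose q hq e using this
    have e1 := h1 r (fun i => (q i).1) (fun i => List.mem_map.2 ⟨_, hq i, rfl⟩)
    have e2 := h2 r (fun i => ((q i).2.1, (q i).1.2)) (fun i => List.mem_map.2 ⟨_, hq i, rfl⟩)
    have e3 := h3 r (fun i => (q i).2) (fun i => List.mem_map.2 ⟨_, hq i, rfl⟩)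
    simp only [e]
    exact e1.trans (e2.symm.trans e3)
  induction m with
  | zero => exact key
  | succ m ih =>
    rintro l ⟨h1, e1, k1⟩ ⟨h2, e2, k2⟩ ⟨h3, e3, k3⟩
    refine ⟨key l h1 h2 h3, (e1.trans e2.symm).trans e3, fun a => ?_⟩
    have := ih (((a, e1 a), (e2.symm (e1 a), e3 (e2.symm (e1 a)))) :: l) (k1 a)
      (by simpa using k2 (e2.symm (e1 a))) (k3 _)
    simpa using this

theorem extend (R : A → B → Prop)
    (hR : ∀ a b a' b', R a b → R a' b → R a' b' → R a b')
    (h0 : A ≃ B) (hh0 : ∀ a, R a (h0 a)) :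
    ∀ l : List (A × B), PI l → (∀ p ∈ l, R p.1 p.2) →
    ∃ h : A ≃ B, (∀ a, R a (h a)) ∧ ∀ p ∈ l, h p.1 = p.2 := by
  classical
  intro l
  induction l with
  | nil => intro _ _; exact ⟨h0, hh0, by simp⟩
  | cons p l ih =>
    intro hP hl
    obtain ⟨h, h1, h2⟩ := ih (fun p hp q hq => hP p (by simp [hp]) q (by simp [hq]))
      (fun p hp => hl p (by simp [hp]))
    have key : ∀ x, ((Equiv.swap p.1 (h.symm p.2)).trans h) x =
        if x = p.1 then p.2 else if x = h.symm p.2 then h p.1 else h x := by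
      intro x
      simp only [Equiv.trans_apply, Equiv.swap_apply_def]
      split_ifs <;> simp
    refine ⟨(Equiv.swap p.1 (h.symm p.2)).trans h, ?_, ?_⟩
    · intro a
      rw [key]
      split_ifs with c1 c2
      · rw [c1]; exact hl p (by simp)
      · apply hR a p.2 p.1 _ _ (hl p (by simp)) (h1 _)
        have := h1 a
        rw [c2] at this ⊢
        simpa using this
      · exact h1 a
    · intro q hq
      rw [key]
      rcases List.mem_cons.1 hq with rfl | hq'
      · simp
      · have e := hP q hq p (by simp)
        split_ifs with c1 c2
        · exact (e.1 c1).symm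
        · exfalso
          apply c1
          apply e.2
          rw [← h2 q hq', c2]; simp
        · exact h2 q hq'

theorem G.toGE {m : ℕ} : ∀ {l : List (A × B)}, G SA SB m l → PI l → GE SA SB m l := by
  induction m with
  | zero => intro l h hp; exact ⟨h, hp⟩
  | succ m ih =>
    intro l hG hp
    have hG' := hG.pred
    obtain ⟨h1, e, h2⟩ := hG
    obtain ⟨h, k1, k2⟩ := extend (fun a b => G SA SB m ((a, b) :: l))
      (by
        intro a b a' b' r1 r2 r3
        have := G.difun (SA := SA) (SB := SB) (m := m)
          (((a, b), (a', b')) :: l.map fun p => (p, p))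
          (by simpa [Function.comp_def] using r1) (by simpa [Function.comp_def] using r2)
          (by simpa [Function.comp_def] using r3)
        simpa [Function.comp_def] using this) e h2 l hp
      (fun p hp => hG'.mono (by simp [hp]))
    refine ⟨⟨h1, hp⟩, h, fun a => ih (k1 a) ?_⟩
    have : ∀ p ∈ (a, h a) :: l, p.2 = h p.1 := by
      intro p hp
      rcases List.mem_cons.1 hp with rfl | hp
      · rfl
      · exact (k2 p hp).symm
    intro p hp q hq
    rw [this p hp, this q hq]
    simp

theorem GE.sat (φ : CFml σ ar) : ∀ (m : ℕ) (l : List (A × B)) (ηA : ℕ → A) (ηB : ℕ → B),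
    φ.qr ≤ m → GE SA SB m l → (∀ x ∈ φ.fv, (ηA x, ηB x) ∈ l) →
    (CFml.Sat SA ηA φ ↔ CFml.Sat SB ηB φ) := by
  have upd : ∀ (φ : CFml σ ar) (x : ℕ) (l : List (A × B)) (ηA : ℕ → A) (ηB : ℕ → B) (a : A) (b : B),
      (∀ y ∈ φ.fv.erase x, (ηA y, ηB y) ∈ l) → ∀ y ∈ φ.fv,
      (Function.update ηA x a y, Function.update ηB x b y) ∈ (a, b) :: l := by
    intro φ x l ηA ηB a b h y hy
    by_cases c : y = x
    · subst c; simp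
    · have := h y (Finset.mem_erase.2 ⟨c, hy⟩)
      simp [c, this]
  induction φ with
  | rel r v =>
    intro m l ηA ηB _ hG hv
    exact hG.at.1 r (fun i => (ηA (v i), ηB (v i))) (fun i => hv _ (by simp [CFml.fv]))
  | eq x y =>
    intro m l ηA ηB _ hG hv
    exact hG.at.2 _ (hv x (by simp [CFml.fv])) _ (hv y (by simp [CFml.fv]))
  | not φ ih =>
    intro m l ηA ηB hq hG hv
    exact not_congr (ih m l ηA ηB hq hG hv)
  | and φ ψ ih1 ih2 =>
    intro m l ηA ηB hq hG hv
    simp only [CFml.qr, max_le_iff] at hq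
    simp only [CFml.fv, Finset.mem_union] at hv
    exact and_congr (ih1 m l ηA ηB hq.1 hG fun x hx => hv x (Or.inl hx))
      (ih2 m l ηA ηB hq.2 hG fun x hx => hv x (Or.inr hx))
  | or φ ψ ih1 ih2 =>
    intro m l ηA ηB hq hG hv
    simp only [CFml.qr, max_le_iff] at hq
    simp only [CFml.fv, Finset.mem_union] at hv
    exact or_congr (ih1 m l ηA ηB hq.1 hG fun x hx => hv x (Or.inl hx))
      (ih2 m l ηA ηB hq.2 hG fun x hx => hv x (Or.inr hx))
  | ex x φ ih =>
    intro m l ηA ηB hq hG hv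
    obtain _ | m := m
    · simp [CFml.qr] at hq
    obtain ⟨_, h, hh⟩ := hG
    have key := fun a => ih m _ (Function.update ηA x a) (Function.update ηB x (h a))
      (by simpa [CFml.qr] using hq) (hh a) (upd φ x l ηA ηB a (h a) hv)
    simp only [CFml.Sat]
    rw [← h.exists_congr_right]
    exact exists_congr key
  | all x φ ih =>
    intro m l ηA ηB hq hG hv
    obtain _ | m := m
    · simp [CFml.qr] at hq
    obtain ⟨_, h, hh⟩ := hG
    have key := fun a => ih m _ (Function.update ηA x a) (Function.update ηB x (h a))
      (by simpa [CFml.qr] using hq) (hh a) (upd φ x l ηA ηB a (h a) hv)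
    simp only [CFml.Sat]
    rw [← h.forall_congr_right]
    exact forall_congr' key
  | exCount n x φ ih =>
    intro m l ηA ηB hq hG hv
    obtain _ | m := m
    · simp [CFml.qr] at hq
    obtain ⟨_, h, hh⟩ := hG
    have key := fun a => ih m _ (Function.update ηA x a) (Function.update ηB x (h a))
      (by simpa [CFml.qr] using hq) (hh a) (upd φ x l ηA ηB a (h a) hv)
    simp only [CFml.Sat]
    constructor
    · rintro ⟨s, hs, h1⟩
      refine ⟨s.map h.toEmbedding, by simpa using hs, ?_⟩
      intro b hb
      obtain ⟨a, ha, rfl⟩ := Finset.mem_map.1 hb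
      exact (key a).1 (h1 a ha)
    · rintro ⟨s, hs, h1⟩
      refine ⟨s.map h.symm.toEmbedding, by simpa using hs, ?_⟩
      intro a ha
      obtain ⟨b, hb, rfl⟩ := Finset.mem_map.1 ha
      exact (key _).2 (by simpa using h1 b hb)

theorem sat_congr (φ : CFml σ ar) : ∀ (η η' : ℕ → A), (∀ x ∈ φ.fv, η x = η' x) →
    (CFml.Sat SA η φ ↔ CFml.Sat SA η' φ) := by
  have upd : ∀ (φ : CFml σ ar) (x : ℕ) (η η' : ℕ → A) (a : A),
      (∀ y ∈ φ.fv.erase x, η y = η' y) → ∀ y ∈ φ.fv,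
      Function.update η x a y = Function.update η' x a y := by
    intro φ x η η' a h y hy
    by_cases c : y = x
    · subst c; simp
    · have := h y (Finset.mem_erase.2 ⟨c, hy⟩)
      simp [c, this]
  induction φ with
  | rel r v =>
    intro η η' h
    have : (fun i => η (v i)) = fun i => η' (v i) := funext fun i => h _ (by simp [CFml.fv])
    simp only [CFml.Sat, this]
  | eq x y =>
    intro η η' h
    simp only [CFml.Sat, h x (by simp [CFml.fv]), h y (by simp [CFml.fv])]
  | not φ ih => intro η η' h; exact not_congr (ih η η' h)
  | and φ ψ ih1 ih2 =>
    intro η η' h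
    simp only [CFml.fv, Finset.mem_union] at h
    exact and_congr (ih1 _ _ fun x hx => h x (Or.inl hx)) (ih2 _ _ fun x hx => h x (Or.inr hx))
  | or φ ψ ih1 ih2 =>
    intro η η' h
    simp only [CFml.fv, Finset.mem_union] at h
    exact or_congr (ih1 _ _ fun x hx => h x (Or.inl hx)) (ih2 _ _ fun x hx => h x (Or.inr hx))
  | ex x φ ih =>
    intro η η' h
    exact exists_congr fun a => ih _ _ (upd φ x η η' a h)
  | all x φ ih =>
    intro η η' h
    exact forall_congr' fun a => ih _ _ (upd φ x η η' a h)
  | exCount n x φ ih =>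
    intro η η' h
    exact exists_congr fun s => and_congr Iff.rfl
      (forall_congr' fun a => forall_congr' fun _ => ih _ _ (upd φ x η η' a h))

/-- Isolating formulas among finitely many points. -/
theorem isolate {C : Type} [Finite C] (S : C → CFml σ ar → Prop) (m n : ℕ)
    (hnot : ∀ c φ, S c (.not φ) ↔ ¬ S c φ) (hand : ∀ c φ ψ, S c (.and φ ψ) ↔ S c φ ∧ S c ψ)
    (heq : ∀ c, S c (.eq 0 0)) (c : C) :
    ∃ ψ : CFml σ ar, ψ.qr ≤ m ∧ ψ.fv ⊆ Finset.range (n + 1) ∧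
      ∀ d, S d ψ ↔ ∀ φ : CFml σ ar, φ.qr ≤ m → φ.fv ⊆ Finset.range (n + 1) → (S d φ ↔ S c φ) := by
  classical
  have h1 : ∀ d, ∃ φ : CFml σ ar, φ.qr ≤ m ∧ φ.fv ⊆ Finset.range (n + 1) ∧ S c φ ∧
      (S d φ → ∀ φ : CFml σ ar, φ.qr ≤ m → φ.fv ⊆ Finset.range (n + 1) → (S d φ ↔ S c φ)) := by
    intro d
    by_cases h : ∀ φ : CFml σ ar, φ.qr ≤ m → φ.fv ⊆ Finset.range (n + 1) → (S d φ ↔ S c φ)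
    · exact ⟨.eq 0 0, by simp [CFml.qr], by simp [CFml.fv], heq c, fun _ => h⟩
    · push Not at h
      obtain ⟨φ, q, f, h⟩ := h
      by_cases hc : S c φ
      · exact ⟨φ, q, f, hc, fun hd => by tauto⟩
      · exact ⟨.not φ, q, f, (hnot _ _).2 hc, fun hd => by rw [hnot] at hd; tauto⟩
  choose Φ q f hc hd using h1
  have h2 : ∀ s : Finset C, ∃ ψ : CFml σ ar, ψ.qr ≤ m ∧ ψ.fv ⊆ Finset.range (n + 1) ∧
      ∀ d, S d ψ ↔ ∀ e ∈ s, S d (Φ e) := by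
    intro s
    induction s using Finset.induction_on with
    | empty => exact ⟨.eq 0 0, by simp [CFml.qr], by simp [CFml.fv], by simp [heq]⟩
    | insert a s _ ih =>
      obtain ⟨ψ, q', f', h⟩ := ih
      refine ⟨.and (Φ a) ψ, ?_, ?_, ?_⟩
      · simp [CFml.qr, q, q']
      · exact Finset.union_subset (f a) f'
      · intro d; rw [hand, h]; simp
  have := Fintype.ofFinite C
  obtain ⟨ψ, q', f', h⟩ := h2 Finset.univ
  refine ⟨ψ, q', f', fun d => ⟨fun hh => hd d ((h d).1 hh d (Finset.mem_univ _)), fun hh => ?_⟩⟩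
  rw [h]
  intro e _
  exact (hh _ (q e) (f e)).2 (hc e)

theorem G_of_sat [Finite A] [Finite B] (m : ℕ) : ∀ (n : ℕ) (ηA : ℕ → A) (ηB : ℕ → B)
    (l : List (A × B)), (∀ p ∈ l, ∃ i < n, p = (ηA i, ηB i)) →
    (∀ φ : CFml σ ar, φ.qr ≤ m → φ.fv ⊆ Finset.range n →
      (CFml.Sat SA ηA φ ↔ CFml.Sat SB ηB φ)) → G SA SB m l := by
  classical
  have hat : ∀ (m n : ℕ) (ηA : ℕ → A) (ηB : ℕ → B)
    (l : List (A × B)), (∀ p ∈ l, ∃ i < n, p = (ηA i, ηB i)) →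
    (∀ φ : CFml σ ar, φ.qr ≤ m → φ.fv ⊆ Finset.range n →
      (CFml.Sat SA ηA φ ↔ CFml.Sat SB ηB φ)) → At SA SB l := by
    intro m n ηA ηB l hl hs r t ht
    choose v hv e using fun i => hl _ (ht i)
    have := hs (.rel r v) (by simp [CFml.qr]) (by
      intro x hx
      simp only [CFml.fv, Finset.mem_image, Finset.mem_univ, true_and] at hx
      obtain ⟨i, rfl⟩ := hx
      simpa using hv i)
    simpa [e, CFml.Sat] using this
  induction m with
  | zero => exact hat 0
  | succ m ih =>
    intro n ηA ηB l hl hs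
    refine ⟨hat _ n ηA ηB l hl hs, ?_⟩
    let S : A ⊕ B → CFml σ ar → Prop := fun c φ => Sum.elim
      (fun a => CFml.Sat SA (Function.update ηA n a) φ)
      (fun b => CFml.Sat SB (Function.update ηB n b) φ) c
    have iso := isolate S m n (by rintro (a | b) φ <;> simp [S, CFml.Sat])
      (by rintro (a | b) φ ψ <;> simp [S, CFml.Sat]) (by rintro (a | b) <;> simp [S, CFml.Sat])
    let τ : A ⊕ B → Set (CFml σ ar) := fun c =>
      {φ | φ.qr ≤ m ∧ φ.fv ⊆ Finset.range (n + 1) ∧ S c φ}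
    have hτ : ∀ c d, τ d = τ c ↔ ∀ φ : CFml σ ar, φ.qr ≤ m → φ.fv ⊆ Finset.range (n + 1) →
        (S d φ ↔ S c φ) := by
      intro c d
      constructor
      · intro h φ q f
        have := Set.ext_iff.1 h φ
        simpa [τ, q, f] using this
      · intro h
        ext φ
        simp only [τ, Set.mem_setOf_eq]
        constructor
        · rintro ⟨q, f, x⟩; exact ⟨q, f, (h φ q f).1 x⟩
        · rintro ⟨q, f, x⟩; exact ⟨q, f, (h φ q f).2 x⟩
    have hfib : ∀ T : Set (CFml σ ar),
        Nonempty ({a // (fun a => τ (Sum.inl a)) a = T} ≃ {b // (fun b => τ (Sum.inr b)) b = T}) := by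
      intro T
      by_cases hT : ∃ c, τ c = T
      · obtain ⟨c, rfl⟩ := hT
        obtain ⟨ψ, q, f, hψ⟩ := iso c
        simp only [← hτ] at hψ
        have hcount := fun N => hs (.exCount N n ψ) (by simpa [CFml.qr] using q) (by
          intro x hx
          simp only [CFml.fv, Finset.mem_erase] at hx
          have := f hx.2
          simp only [Finset.mem_range] at this ⊢
          omega)
        have hA : ∀ a, CFml.Sat SA (Function.update ηA n a) ψ ↔ τ (Sum.inl a) = τ c :=
          fun a => hψ (Sum.inl a)
        have hB : ∀ b, CFml.Sat SB (Function.update ηB n b) ψ ↔ τ (Sum.inr b) = τ c :=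
          fun b => hψ (Sum.inr b)
        simp only [CFml.Sat, hA, hB] at hcount
        have := Fintype.ofFinite A
        have := Fintype.ofFinite B
        have e : Fintype.card {a // τ (Sum.inl a) = τ c} = Fintype.card {b // τ (Sum.inr b) = τ c} := by
          rw [Fintype.card_subtype, Fintype.card_subtype]
          apply le_antisymm
          · obtain ⟨s, h1, h2⟩ := (hcount _).1 ⟨Finset.univ.filter fun a => τ (Sum.inl a) = τ c, rfl, by simp⟩
            rw [← h1]
            exact Finset.card_le_card fun x hx => by simp [h2 x hx]
          · obtain ⟨s, h1, h2⟩ := (hcount _).2 ⟨Finset.univ.filter fun b => τ (Sum.inr b) = τ c, rfl, by simp⟩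
            rw [← h1]
            exact Finset.card_le_card fun x hx => by simp [h2 x hx]
        exact ⟨Fintype.equivOfCardEq e⟩
      · have : IsEmpty {a // (fun a => τ (Sum.inl a)) a = T} := ⟨fun a => hT ⟨_, a.2⟩⟩
        have : IsEmpty {b // (fun b => τ (Sum.inr b)) b = T} := ⟨fun a => hT ⟨_, a.2⟩⟩
        exact ⟨Equiv.equivOfIsEmpty _ _⟩
    let h : A ≃ B := Equiv.ofFiberEquiv fun T => (hfib T).some
    have hh : ∀ a, τ (Sum.inr (h a)) = τ (Sum.inl a) :=
      fun a => Equiv.ofFiberEquiv_map (fun T => (hfib T).some) a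
    refine ⟨h, fun a => ih (n + 1) (Function.update ηA n a) (Function.update ηB n (h a)) _ ?_ ?_⟩
    · intro p hp
      rcases List.mem_cons.1 hp with rfl | hp
      · exact ⟨n, by omega, by simp⟩
      · obtain ⟨i, hi, e⟩ := hl p hp
        refine ⟨i, by omega, ?_⟩
        have : i ≠ n := by omega
        simp [this, e]
    · intro φ q f
      exact ((hτ _ _).1 (hh a) φ q f).symm

/-! From `G` to an isomorphism. -/

def Fm (H : List (A × B) → A ≃ B) : List (A × B) → List A → List B
  | _, [] => []
  | l, a :: s => H l a :: Fm H ((a, H l a) :: l) s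

def Fi (H : List (A × B) → A ≃ B) : List (A × B) → List B → List A
  | _, [] => []
  | l, b :: s => (H l).symm b :: Fi H (((H l).symm b, b) :: l) s

def pl (H : List (A × B) → A ≃ B) : List (A × B) → List A → List (A × B)
  | l, [] => l
  | l, a :: s => pl H ((a, H l a) :: l) s

variable (H : List (A × B) → A ≃ B)

theorem Fi_Fm (s : List A) : ∀ l, Fi H l (Fm H l s) = s := by
  induction s with
  | nil => intro l; rfl
  | cons a s ih => intro l; simp [Fm, Fi, ih]

theorem Fm_Fi (s : List B) : ∀ l, Fm H l (Fi H l s) = s := by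
  induction s with
  | nil => intro l; rfl
  | cons a s ih => intro l; simp [Fm, Fi, ih]

theorem Fm_length (s : List A) : ∀ l, (Fm H l s).length = s.length := by
  induction s with
  | nil => intro l; rfl
  | cons a s ih => intro l; simp [Fm, ih]

theorem Fi_length (s : List B) : ∀ l, (Fi H l s).length = s.length := by
  induction s with
  | nil => intro l; rfl
  | cons a s ih => intro l; simp [Fi, ih]

theorem Fm_prefix (s : List A) : ∀ l s', s <+: s' ↔ Fm H l s <+: Fm H l s' := by
  induction s with
  | nil => intro l s'; simp [Fm]
  | cons a s ih =>
    intro l s'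
    cases s' with
    | nil => simp [Fm]
    | cons b s' =>
      simp only [Fm, List.cons_prefix_cons, EmbeddingLike.apply_eq_iff_eq]
      constructor
      · rintro ⟨rfl, h⟩; exact ⟨rfl, (ih _ _).1 h⟩
      · rintro ⟨rfl, h⟩; exact ⟨rfl, (ih _ _).2 h⟩

theorem pl_sub (s : List A) : ∀ l, l ⊆ pl H l s := by
  induction s with
  | nil => intro l; exact fun x hx => hx
  | cons a s ih =>
    intro l
    exact fun x hx => ih ((a, H l a) :: l) (List.mem_cons_of_mem _ hx)

theorem pl_mem (s : List A) : ∀ l s' (h : s ≠ []) (h' : Fm H l s ≠ []), s <+: s' →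
    (s.getLast h, (Fm H l s).getLast h') ∈ pl H l s' := by
  induction s with
  | nil => intro l s' h; exact absurd rfl h
  | cons a s ih =>
    intro l s' h h' hp
    cases s' with
    | nil => simp at hp
    | cons b s' =>
      rw [List.cons_prefix_cons] at hp
      obtain ⟨rfl, hp⟩ := hp
      cases s with
      | nil => simpa [Fm, pl] using pl_sub H s' ((a, H l a) :: l) (List.mem_cons_self ..)
      | cons c s =>
        have := ih ((a, H l a) :: l) s' (by simp) (by simp [Fm]) hp
        simpa only [Fm, pl, List.getLast_cons_cons] using this

theorem pl_G {k : ℕ} (hH : ∀ l m, G SA SB (m + 1) l → l.length + (m + 1) = k → ∀ a, G SA SB m ((a, H l a) :: l))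
    (s : List A) : ∀ l m, G SA SB (m + s.length) l → l.length + (m + s.length) = k →
      G SA SB m (pl H l s) := by
  induction s with
  | nil => intro l m h _; exact h
  | cons a s ih =>
    intro l m h hl
    simp only [List.length_cons] at hl
    exact ih _ m (hH l (m + s.length) h (by omega) a) (by simp; omega)

theorem exists_H {k : ℕ} (hk : 0 < k) (h : G SA SB k []) : ∃ H : List (A × B) → A ≃ B,
    ∀ l m, G SA SB (m + 1) l → l.length + (m + 1) = k → ∀ a, G SA SB m ((a, H l a) :: l) := by
  obtain ⟨k, rfl⟩ : ∃ k', k = k' + 1 := ⟨k - 1, by omega⟩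
  obtain ⟨_, h0, -⟩ := h
  have : ∀ l : List (A × B), ∃ h : A ≃ B, ∀ m, G SA SB (m + 1) l → l.length + (m + 1) = k + 1 →
      ∀ a, G SA SB m ((a, h a) :: l) := by
    intro l
    by_cases c : ∃ m, G SA SB (m + 1) l ∧ l.length + (m + 1) = k + 1
    · obtain ⟨m, ⟨_, h, hh⟩, e⟩ := c
      refine ⟨h, fun m' _ e' => ?_⟩
      obtain rfl : m' = m := by omega
      exact hh
    · exact ⟨h0, fun m h1 h2 => absurd ⟨m, h1, h2⟩ c⟩
  choose H hH using this
  exact ⟨H, hH⟩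

theorem ord_pres {X Y : OStruct σ ar} (f : X.carrier → Y.carrier) (g : Y.carrier → X.carrier)
    (gf : ∀ x, g (f x) = x) (fg : ∀ y, f (g y) = y) (le : ∀ x y, X.le x y ↔ Y.le (f x) (f y)) :
    (∀ x, X.IsRoot x → Y.IsRoot (f x)) ∧ (∀ x y, X.Covers x y → Y.Covers (f x) (f y)) := by
  constructor
  · intro x hx y hy
    have := hx (g y) ((le _ _).2 (by rwa [fg]))
    rw [← this, fg]
  · rintro x y ⟨⟨h1, h2⟩, h3⟩
    refine ⟨⟨(le _ _).1 h1, fun e => h2 (by rw [← gf x, e, gf])⟩, fun z hz1 hz2 => ?_⟩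
    rcases h3 (g z) ((le _ _).2 (by rwa [fg])) ((le _ _).2 (by rwa [fg])) with e | e
    · left; rw [← e, fg]
    · right; rw [← e, fg]

theorem exists_top {k : ℕ} {n : ℕ} (hn : 0 < n) (t : Fin n → EkCarrier k A)
    (h : ∀ i j, (t i).1 <+: (t j).1 ∨ (t j).1 <+: (t i).1) : ∃ j, ∀ i, (t i).1 <+: (t j).1 := by
  have : Nonempty (Fin n) := ⟨⟨0, hn⟩⟩
  obtain ⟨j, hj⟩ := Finite.exists_max fun i => (t i).1.length
  refine ⟨j, fun i => ?_⟩
  rcases h i j with h | h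
  · exact h
  · rw [h.eq_of_length (le_antisymm h.length_le (hj i))]

theorem iso_of_G (har : ∀ r, 0 < ar r) {k : ℕ} (hk : 0 < k) (hG : G SA SB k []) :
    ∃ (f : EkCarrier k A → EkCarrier k B) (g : EkCarrier k B → EkCarrier k A),
        IsFMor (GkO k SA) (GkO k SB) f ∧ IsFMor (GkO k SB) (GkO k SA) g ∧
        (∀ x, g (f x) = x) ∧ (∀ y, f (g y) = y) ∧
        (∀ x y, (GkO k SA).le x y ↔ (GkO k SB).le (f x) (f y)) := by
  obtain ⟨H, hH⟩ := exists_H hk hG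
  let f : EkCarrier k A → EkCarrier k B := fun s => ⟨Fm H [] s.1, by
    rw [← List.length_pos_iff_ne_nil, Fm_length, List.length_pos_iff_ne_nil]; exact s.2⟩
  let g : EkCarrier k B → EkCarrier k A := fun s => ⟨Fi H [] s.1, by
    rw [← List.length_pos_iff_ne_nil, Fi_length, List.length_pos_iff_ne_nil]; exact s.2⟩
  have gf : ∀ x, g (f x) = x := fun x => Subtype.ext (Fi_Fm H x.1 [])
  have fg : ∀ y, f (g y) = y := fun x => Subtype.ext (Fm_Fi H x.1 [])
  have le : ∀ x y, (GkO k SA).le x y ↔ (GkO k SB).le (f x) (f y) :=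
    fun x y => Fm_prefix H x.1 [] y.1
  have le' : ∀ x y, (GkO k SB).le x y ↔ (GkO k SA).le (g x) (g y) :=
    fun x y => by
      have h := le (g x) (g y)
      have ex : f (g x) = x := fg x
      have ey : f (g y) = y := fg y
      rw [ex, ey] at h
      exact h.symm
  have hom : ∀ (r : σ) (t : Fin (ar r) → EkCarrier k A),
      t ∈ EkInterp k SA r ↔ (fun i => f (t i)) ∈ EkInterp k SB r := by
    intro r t
    have c : (∀ i j, (t i).1 <+: (t j).1 ∨ (t j).1 <+: (t i).1) ↔
        (∀ i j, (f (t i)).1 <+: (f (t j)).1 ∨ (f (t j)).1 <+: (f (t i)).1) :=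
      forall_congr' fun i => forall_congr' fun j => or_congr (le _ _) (le _ _)
    constructor
    · rintro ⟨h1, h2⟩
      refine ⟨c.1 h1, ?_⟩
      obtain ⟨j, hj⟩ := exists_top (har r) t h1
      have := (pl_G H hH (t j).1 [] (k - (t j).1.length)
        (by rwa [Nat.sub_add_cancel (t j).2.2]) (by have := (t j).2.2; simp; omega)).at
      exact (this r (fun i => (εE (t i), εE (f (t i))))
        (fun i => pl_mem H (t i).1 [] (t j).1 _ _ (hj i))).1 h2
    · rintro ⟨h1, h2⟩
      have h1 := c.2 h1
      refine ⟨h1, ?_⟩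
      obtain ⟨j, hj⟩ := exists_top (har r) t h1
      have := (pl_G H hH (t j).1 [] (k - (t j).1.length)
        (by rwa [Nat.sub_add_cancel (t j).2.2]) (by have := (t j).2.2; simp; omega)).at
      exact (this r (fun i => (εE (t i), εE (f (t i))))
        (fun i => pl_mem H (t i).1 [] (t j).1 _ _ (hj i))).2 h2
  refine ⟨f, g, ⟨fun r t ht => (hom r t).1 ht,
    ord_pres (X := GkO k SA) (Y := GkO k SB) f g gf fg le⟩, ⟨fun r t ht => (hom r _).2 ?_,
    ord_pres (X := GkO k SB) (Y := GkO k SA) g f fg gf le'⟩, gf, fg, le⟩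
  have e : (fun i => f (g (t i))) = t := funext fun i => fg (t i)
  exact e.symm ▸ ht

/-! From an isomorphism to `G`. -/

def Link {k : ℕ} (f : EkCarrier k A → EkCarrier k B) (s : List A) (t : List B) : Prop :=
  (s = [] ∧ t = []) ∨ ∃ x, x.1 = s ∧ (f x).1 = t

theorem child {k : ℕ} {f : EkCarrier k A → EkCarrier k B} (hf : IsFMor (GkO k SA) (GkO k SB) f)
    {s : List A} {t : List B} (hl : Link f s t) (x : EkCarrier k A) (a : A) (hx : x.1 = s ++ [a]) :
    (f x).1 = t ++ [εE (f x)] := by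
  suffices h : ∃ b, (f x).1 = t ++ [b] by
    obtain ⟨b, hb⟩ := h
    rw [hb]
    congr 2
    simp [εE, hb]
  rcases hl with ⟨rfl, rfl⟩ | ⟨y, rfl, rfl⟩
  · have hr : (GkO k SA).IsRoot x := by
      intro z hz
      have hz : z.1 <+: x.1 := hz
      apply Subtype.ext
      apply hz.eq_of_length
      have := hz.length_le
      have := List.length_pos_iff_ne_nil.2 z.2.1
      simp [hx] at *
      omega
    have := hf.2.1 x hr
    obtain ⟨b, u, hu⟩ := List.exists_cons_of_ne_nil (f x).2.1
    have hk := (f x).2.2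
    refine ⟨b, ?_⟩
    have e := this ⟨[b], by simp, by rw [hu] at hk; simp at *; omega⟩
      (show [b] <+: (f x).1 by simp [hu])
    rw [← e]; rfl
  · have hc : (GkO k SA).Covers y x := by
      refine ⟨⟨?_, ?_⟩, ?_⟩
      · show y.1 <+: x.1
        simp [hx]
      · rintro rfl
        simpa using congrArg List.length hx
      · intro z h1 h2
        have h1 : y.1 <+: z.1 := h1
        have h2 : z.1 <+: x.1 := h2
        have l1 := h1.length_le
        have l2 := h2.length_le
        have l3 : x.1.length = y.1.length + 1 := by simp [hx]
        by_cases c : z.1.length = y.1.length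
        · left; exact (Subtype.ext (h1.eq_of_length c.symm)).symm
        · right; exact Subtype.ext (h2.eq_of_length (by omega))
    obtain ⟨⟨h1, h2⟩, h3⟩ := hf.2.2 y x hc
    obtain ⟨u, hu⟩ : (f y).1 <+: (f x).1 := h1
    cases u with
    | nil => exact absurd (Subtype.ext (by simpa using hu)) h2
    | cons b u =>
      refine ⟨b, ?_⟩
      have hk := (f x).2.2
      have e := h3 ⟨(f y).1 ++ [b], by simp, by rw [← hu] at hk; simp at *; omega⟩
        (show (f y).1 <+: (f y).1 ++ [b] by simp)
        (show (f y).1 ++ [b] <+: (f x).1 by rw [← hu]; simp)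
      rcases e with e | e
      · simpa using congrArg (fun z => List.length z.1) e
      · rw [← e]

theorem G_of_iso {k : ℕ} {f : EkCarrier k A → EkCarrier k B} {g : EkCarrier k B → EkCarrier k A}
    (hf : IsFMor (GkO k SA) (GkO k SB) f) (hg : IsFMor (GkO k SB) (GkO k SA) g)
    (gf : ∀ x, g (f x) = x) (fg : ∀ y, f (g y) = y)
    (le : ∀ x y, (GkO k SA).le x y ↔ (GkO k SB).le (f x) (f y)) (m : ℕ) :
    ∀ (s : List A) (t : List B) (l : List (A × B)), Link f s t → s.length = t.length →
      s.length + m = k → (∀ p ∈ l, ∃ x : EkCarrier k A, x.1 <+: s ∧ p = (εE x, εE (f x))) →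
      G SA SB m l := by
  have hat : ∀ (s : List A) (l : List (A × B)),
      (∀ p ∈ l, ∃ x : EkCarrier k A, x.1 <+: s ∧ p = (εE x, εE (f x))) → At SA SB l := by
    intro s l hl r t ht
    choose x hx e using fun i => hl _ (ht i)
    simp only [e]
    have hc : ∀ i j, (x i).1 <+: (x j).1 ∨ (x j).1 <+: (x i).1 :=
      fun i j => List.prefix_or_prefix_of_prefix (hx i) (hx j)
    constructor
    · intro h
      exact (hf.1 r x ⟨hc, h⟩).2
    · intro h
      have h1 : (fun i => f (x i)) ∈ EkInterp k SB r := by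
        refine ⟨?_, h⟩
        intro i j
        exact (hc i j).imp (le _ _).1 (le _ _).1
      have := (hg.1 r _ h1).2
      simpa only [gf] using this
  induction m with
  | zero => intro s t l _ _ _ hl; exact hat s l hl
  | succ m ih =>
    intro s t l hst hlen hk hl
    refine ⟨hat s l hl, ?_⟩
    have hts : Link g t s := by
      rcases hst with ⟨rfl, rfl⟩ | ⟨x, rfl, rfl⟩
      · exact Or.inl ⟨rfl, rfl⟩
      · exact Or.inr ⟨f x, rfl, by rw [gf]⟩
    let xa : A → EkCarrier k A := fun a => ⟨s ++ [a], by simp, by simp; omega⟩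
    let yb : B → EkCarrier k B := fun b => ⟨t ++ [b], by simp, by simp; omega⟩
    have hx : ∀ a, εE (xa a) = a := fun a => by simp [εE, xa]
    have hy : ∀ a, εE (yb a) = a := fun a => by simp [εE, yb]
    have h1 : ∀ a, f (xa a) = yb (εE (f (xa a))) := fun a => Subtype.ext (child hf hst (xa a) a rfl)
    have h2 : ∀ b, g (yb b) = xa (εE (g (yb b))) := fun b => Subtype.ext (child hg hts (yb b) b rfl)
    refine ⟨⟨fun a => εE (f (xa a)), fun b => εE (g (yb b)), fun a => ?_, fun b => ?_⟩, fun a => ?_⟩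
    · show εE (g (yb (εE (f (xa a))))) = a
      rw [← h1, gf, hx]
    · show εE (f (xa (εE (g (yb b))))) = b
      rw [← h2, fg, hy]
    · refine ih (s ++ [a]) (f (xa a)).1 _ (Or.inr ⟨xa a, rfl, rfl⟩) ?_ (by simp; omega) ?_
      · rw [h1]; simp [yb, hlen]
      · intro p hp
        rcases List.mem_cons.1 hp with rfl | hp
        · exact ⟨xa a, List.prefix_rfl, by simp [hx]⟩
        · obtain ⟨x, h, e⟩ := hl p hp
          exact ⟨x, h.trans (by simp), e⟩

end Proof

/-- For a finite relational vocabulary σ, finite σ-structures A, B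
and `k > 0`: `G_k A` and `G_k B` are isomorphic in `RT_k(σ)` iff A and B satisfy the
same sentences of quantifier rank ≤ `k` of first-order logic with counting
quantifiers. -/
theorem stmt5 {σ : Type} [Fintype σ] {ar : σ → ℕ} (har : ∀ r, 0 < ar r)
    {A B : Type} [Finite A] [Finite B]
    (SA : Interp σ ar A) (SB : Interp σ ar B) (k : ℕ) (hk : 0 < k) :
    (∃ (f : EkCarrier k A → EkCarrier k B) (g : EkCarrier k B → EkCarrier k A),
        IsFMor (GkO k SA) (GkO k SB) f ∧ IsFMor (GkO k SB) (GkO k SA) g ∧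
        (∀ x, g (f x) = x) ∧ (∀ y, f (g y) = y) ∧
        (∀ x y, (GkO k SA).le x y ↔ (GkO k SB).le (f x) (f y))) ↔
      ∀ φ : CFml σ ar, φ.qr ≤ k → φ.fv = ∅ →
        ((∀ η : ℕ → A, CFml.Sat SA η φ) ↔ (∀ η : ℕ → B, CFml.Sat SB η φ)) := by
  constructor
  · rintro ⟨f, g, hf, hg, gf, fg, le⟩ φ hq hfv
    have hG : G SA SB k [] := G_of_iso hf hg gf fg le k [] [] [] (Or.inl ⟨rfl, rfl⟩) rfl (by simp)
      (by simp)
    have hGE := hG.toGE (by simp [PI])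
    have key : ∀ ηA ηB, CFml.Sat SA ηA φ ↔ CFml.Sat SB ηB φ :=
      fun ηA ηB => GE.sat φ k [] ηA ηB hq hGE (by simp [hfv])
    obtain ⟨h⟩ : Nonempty (A ≃ B) := by
      obtain ⟨k, rfl⟩ : ∃ k', k = k' + 1 := ⟨k - 1, by omega⟩
      exact ⟨hG.2.choose⟩
    constructor
    · intro h1 η
      exact (key (fun n => h.symm (η n)) η).1 (h1 _)
    · intro h1 η
      exact (key η (fun n => h (η n))).2 (h1 _)
  · intro hs
    apply iso_of_G har hk
    have hbot := hs (.ex 0 (.not (.eq 0 0))) (by simp only [CFml.qr]; omega) (by simp [CFml.fv])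
    simp only [CFml.Sat, not_true_eq_false, exists_false] at hbot
    rcases isEmpty_or_nonempty A with hA | ⟨⟨a⟩⟩
    · have hB : IsEmpty B := ⟨fun b => hbot.1 (fun η => hA.false (η 0)) (fun _ => b)⟩
      have hat : At SA SB [] := fun r t ht => absurd (ht ⟨0, har r⟩) (by simp)
      cases k with
      | zero => exact hat
      | succ k => exact ⟨hat, Equiv.equivOfIsEmpty _ _, fun a => hA.elim a⟩
    · rcases isEmpty_or_nonempty B with hB | ⟨⟨b⟩⟩
      · exact (hbot.2 (fun η => hB.false (η 0)) (fun _ => a)).elim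
      · refine G_of_sat k 0 (fun _ => a) (fun _ => b) [] (by simp) fun φ hq hfv => ?_
        have hfv : φ.fv = ∅ := by simpa using hfv
        have := hs φ hq hfv
        constructor
        · intro h
          exact this.1 (fun η => (sat_congr φ _ _ (by simp [hfv])).1 h) _
        · intro h
          exact this.2 (fun η => (sat_congr φ _ _ (by simp [hfv])).1 h) _

end SP
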